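/- Let b > 0 and let (a_t)_{t≥1} be a sequence of real numbers satisfying 0 ≤ a_{t+1} ≤ (1 − b/t)·a_t + c_t for all t ≥ 1, where (c_t) is a sequence of real numbers with t·c_t → 0 as t → ∞ (i.e. c_t = o(1)/t). Then a_t → 0. -/

import Mathlib

open Filter

/-- A nonnegative sequence that eventually contracts by the factor `1 - b / t` tends to `0`,
because the harmonic series diverges. -/
theorem tendsto_zero_of_le_one_sub_div_mul
    {b : ℝ} (hb : 0 < b) {v : ℕ → ℝ} (hv : ∀ t, 0 ≤ v t)
    (h : ∀ᶠ t : ℕ in atTop, v (t + 1) ≤ (1 - b / t) * v t) :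
    Tendsto v atTop (nhds 0) := by
  obtain ⟨N, hN⟩ := eventually_atTop.1 h
  set S : ℕ → ℝ := fun n => ∑ i ∈ Finset.range n, 1 / (i : ℝ) with hS
  have hS_top : Tendsto S atTop atTop :=
    (not_summable_iff_tendsto_nat_atTop_of_nonneg fun i => by positivity).1
      Real.not_summable_one_div_natCast
  have bound : ∀ t, N ≤ t → v t * Real.exp (b * S t) ≤ v N * Real.exp (b * S N) := by
    intro t ht
    induction t, ht using Nat.le_induction with
    | base => exact le_rfl
    | succ t ht ih =>
      refine le_trans ?_ ih
      have hexp : Real.exp (b * S (t + 1)) = Real.exp (b / t) * Real.exp (b * S t) := by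
        rw [← Real.exp_add, hS]
        simp only [Finset.sum_range_succ]
        ring_nf
      have hfactor : (1 - b / t) * Real.exp (b / t) ≤ 1 := by
        calc (1 - b / t) * Real.exp (b / t)
            ≤ Real.exp (-(b / t)) * Real.exp (b / t) :=
              mul_le_mul_of_nonneg_right (Real.one_sub_le_exp_neg _) (Real.exp_pos _).le
          _ = 1 := by rw [← Real.exp_add, neg_add_cancel, Real.exp_zero]
      have hpos : 0 ≤ v t * Real.exp (b * S t) := mul_nonneg (hv t) (Real.exp_pos _).le
      calc v (t + 1) * Real.exp (b * S (t + 1))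
          ≤ ((1 - b / t) * v t) * Real.exp (b * S (t + 1)) :=
            mul_le_mul_of_nonneg_right (hN t ht) (Real.exp_pos _).le
        _ = ((1 - b / t) * Real.exp (b / t)) * (v t * Real.exp (b * S t)) := by
            rw [hexp]; ring
        _ ≤ v t * Real.exp (b * S t) := mul_le_of_le_one_left hpos hfactor
  have hlim : Tendsto (fun t => v N * Real.exp (b * S N) * Real.exp (-(b * S t)))
      atTop (nhds 0) := by
    simpa using (Real.tendsto_exp_neg_atTop_nhds_zero.comp
      (hS_top.const_mul_atTop hb)).const_mul (v N * Real.exp (b * S N))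
  refine squeeze_zero' (Eventually.of_forall hv) ?_ hlim
  filter_upwards [eventually_ge_atTop N] with t ht
  rw [Real.exp_neg, ← div_eq_mul_inv, le_div_iff₀ (Real.exp_pos _)]
  exact bound t ht

/-- Recursive-inequality lemma: if b > 0 and 0 ≤ a_{t+1} ≤ (1 - b/t)·a_t + c_t for
all t ≥ 1, where t·c_t → 0 (i.e. c_t = o(1)/t), then a_t → 0. -/
theorem recursive_sequence_tendsto_zero
    (b : ℝ) (hb : 0 < b) (a c : ℕ → ℝ)
    (hrec : ∀ t : ℕ, 1 ≤ t →
      0 ≤ a (t + 1) ∧ a (t + 1) ≤ (1 - b / t) * a t + c t)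
    (hc : Tendsto (fun t : ℕ => (t : ℝ) * c t) atTop (nhds 0)) :
    Tendsto a atTop (nhds 0) := by
  have step : ∀ ε : ℝ, 0 < ε → Tendsto (fun t => max (a t - ε) 0) atTop (nhds 0) := by
    intro ε hε
    refine tendsto_zero_of_le_one_sub_div_mul hb (fun t => le_max_right _ _) ?_
    filter_upwards [hc.eventually_lt_const (mul_pos hb hε), eventually_ge_atTop 1,
      tendsto_natCast_atTop_atTop.eventually_ge_atTop b] with t hct ht hbt
    have ht0 : (0 : ℝ) < t := by exact_mod_cast ht
    have hfactor : 0 ≤ 1 - b / t := sub_nonneg.2 ((div_le_one ht0).2 hbt)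
    refine max_le ?_ (mul_nonneg hfactor (le_max_right _ _))
    have hc' : c t ≤ b / t * ε := by
      rw [div_mul_eq_mul_div, le_div_iff₀ ht0, mul_comm]
      exact hct.le
    have hmax := mul_le_mul_of_nonneg_left (le_max_left (a t - ε) 0) hfactor
    linarith [(hrec t ht).2]
  rw [Metric.tendsto_atTop']
  intro ε hε
  obtain ⟨N, hN⟩ := eventually_atTop.1
    ((step (ε / 2) (half_pos hε)).eventually_lt_const (half_pos hε))
  refine ⟨max N 1, fun n hn => ?_⟩
  have hn1 : 1 < n := (le_max_right N 1).trans_lt hn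
  have hpos : 0 ≤ a n := by
    simpa [Nat.sub_add_cancel hn1.le] using (hrec (n - 1) (by omega)).1
  rw [Real.dist_eq, sub_zero, abs_of_nonneg hpos]
  linarith [(le_max_left (a n - ε / 2) 0).trans_lt
    (hN n ((le_max_left N 1).trans hn.le))]
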